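/- arXiv:1401.5613 — 2 statements merged into one kernel-verified Lean document; each statement's English description precedes it below -/
import Mathlib

section
/- Payoff transformation: in the change-point model below, let d₁, d₂ ∈ ℕ and assume n ≥ d₁ + 1. Then ν-almost everywhere the conditional probability of detecting the change within tolerance (d₁, d₂) at time n satisfies ν(n − d₁ ≤ θ ≤ n + d₂ | 𝓕_n) = (1 − Π_n) · (1 − p^{d₂} + q ∑_{m=1}^{d₁+1} L_m(X_{n−d₁−1}, …, X_n) / (p^m L₀(X_{n−d₁−1}, …, X_n))), where Π_n := ν(θ ≤ n | 𝓕_n). -/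
open MeasureTheory Finset
open scoped NNReal ENNReal

noncomputable section

/-- `L_m(x_k, …, x_N) = ∏_{r=k+1}^{N-m} f⁰(x_{r-1}, x_r) · ∏_{r=N-m+1}^{N} f¹(x_{r-1}, x_r)`. -/
def Lfn {E : Type*} (f0 f1 : E → E → ℝ≥0) (k N m : ℕ) (xv : ℕ → E) : ℝ≥0 :=
  (∏ r ∈ Finset.Icc (k + 1) (N - m), f0 (xv (r - 1)) (xv r)) *
    ∏ r ∈ Finset.Icc (N - m + 1) N, f1 (xv (r - 1)) (xv r)

/-- Density `ℓ_j(x₀,…,x_n)` of the observations given the change point `θ = j`: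
`ℓ_j = L_{n-j+1}` if `1 ≤ j ≤ n`, `ℓ₀ = L_n`, `ℓ_j = L₀` for `j > n`. -/
def ellDens {E : Type*} (f0 f1 : E → E → ℝ≥0) (n j : ℕ) (xv : ℕ → E) : ℝ≥0 :=
  if j = 0 then Lfn f0 f1 0 n n xv
  else if j ≤ n then Lfn f0 f1 0 n (n - j + 1) xv
  else Lfn f0 f1 0 n 0 xv

/-- Extension of the observations `(x₁, …, x_n)` to a full trajectory `(x₀, x₁, …, x_n)`
with `x₀ = x` (entries beyond `n` are irrelevant and set to `x`). -/
def extvec {E : Type*} (n : ℕ) (x : E) (xs : Fin n → E) : ℕ → E := fun r =>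
  if h : 1 ≤ r ∧ r ≤ n then xs ⟨r - 1, by omega⟩ else x

/-- The prior distribution of the change point: `ρ 0 = π`, `ρ j = (1-π) p^(j-1) (1-p)`, `j ≥ 1`. -/
def prior (p π : ℝ) (j : ℕ) : ℝ≥0∞ :=
  if j = 0 then ENNReal.ofReal π else ENNReal.ofReal ((1 - π) * p ^ (j - 1) * (1 - p))

/-- The joint law `ν` of `(θ, X₁, …, X_n)` given `X₀ = x`: its restriction to `{j} × Eⁿ` is
`ρ j` times the measure with density `(x₁,…,x_n) ↦ ℓ_j(x, x₁, …, x_n)` w.r.t. `μ^⊗n`. -/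
def nuMeasure {E : Type*} [MeasurableSpace E] (μ : Measure E) (f0 f1 : E → E → ℝ≥0)
    (p π : ℝ) (x : E) (n : ℕ) : Measure (ℕ × (Fin n → E)) :=
  Measure.sum fun j =>
    prior p π j •
      Measure.map (fun xs => (j, xs))
        ((Measure.pi fun _ : Fin n => μ).withDensity fun xs =>
          (ellDens f0 f1 n j (extvec n x xs) : ℝ≥0∞))

/-- `S(x₀, …, x_m) = π L_m + (1-π)(∑_{i=1}^m p^{i-1} q L_{m-i+1} + p^m L₀)`. -/
def Sfn {E : Type*} (f0 f1 : E → E → ℝ≥0) (p π : ℝ) (m : ℕ) (xv : ℕ → E) : ℝ :=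
  π * (Lfn f0 f1 0 m m xv : ℝ) +
    (1 - π) * ((∑ i ∈ Finset.Icc 1 m, p ^ (i - 1) * (1 - p) * (Lfn f0 f1 0 m (m - i + 1) xv : ℝ)) +
      p ^ m * (Lfn f0 f1 0 m 0 xv : ℝ))

/-- `G_{l+1}(x_k, …, x_{k+l+1}, α) = α L_{l+1} + (1-α)(∑_{i=0}^{l} p^{l-i} q L_{i+1} + p^{l+1} L₀)`. -/
def Gfn {E : Type*} (f0 f1 : E → E → ℝ≥0) (p : ℝ) (k l : ℕ) (xv : ℕ → E) (α : ℝ) : ℝ :=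
  α * (Lfn f0 f1 k (k + l + 1) (l + 1) xv : ℝ) +
    (1 - α) *
      ((∑ i ∈ Finset.range (l + 1), p ^ (l - i) * (1 - p) * (Lfn f0 f1 k (k + l + 1) (i + 1) xv : ℝ)) +
        p ^ (l + 1) * (Lfn f0 f1 k (k + l + 1) 0 xv : ℝ))

/-- The σ-algebra `𝓕_m` generated by the observations `(X₁, …, X_m)`, `m ≤ n`. -/
def Ffil {E : Type*} [MeasurableSpace E] (n m : ℕ) (h : m ≤ n) :
    MeasurableSpace (ℕ × (Fin n → E)) :=
  MeasurableSpace.comap (fun ω => fun i : Fin m => ω.2 (Fin.castLE h i)) inferInstance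

end

open MeasureTheory

lemma extvec_meas {E : Type*} [MeasurableSpace E] (n : ℕ) (r : ℕ) :
    Measurable (fun q : E × (Fin n → E) => extvec n q.1 q.2 r) := by
  unfold extvec
  split_ifs with h
  · exact (measurable_pi_apply _).comp measurable_snd
  · exact measurable_fst

lemma extvec_meas' {E : Type*} [MeasurableSpace E] (n : ℕ) (x : E) (r : ℕ) :
    Measurable (fun q : (Fin n → E) => extvec n x q r) :=
  (extvec_meas n r).comp (measurable_const.prodMk measurable_id)

lemma extvec_cons {E : Type*} (n : ℕ) (x y : E) (xs : Fin n → E) (r : ℕ) (hr : r ≤ n) :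
    extvec (n + 1) x (Fin.cons y xs : Fin (n + 1) → E) (r + 1) = extvec n y xs r := by
  unfold extvec
  rcases r with _ | r
  · simp
  · have h1 : 1 ≤ r + 1 + 1 ∧ r + 1 + 1 ≤ n + 1 := by omega
    have h2 : 1 ≤ r + 1 ∧ r + 1 ≤ n := by omega
    rw [dif_pos h1, dif_pos h2]
    exact Fin.cons_succ (α := fun _ => E) y xs ⟨r, by omega⟩

lemma extvec_zero {E : Type*} (n : ℕ) (x : E) (xs : Fin n → E) : extvec n x xs 0 = x := by
  simp [extvec]

lemma path_lintegral {E : Type*} [MeasurableSpace E] (μ : Measure E) [SigmaFinite μ] (n : ℕ) :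
    ∀ (g : ℕ → E → E → ℝ≥0) (_ : ∀ r, Measurable (Function.uncurry (g r)))
      (_ : ∀ r z, ∫⁻ y, (g r z y : ℝ≥0∞) ∂μ = 1) (x : E),
    ∫⁻ xs, ∏ r ∈ Finset.range n, (g r (extvec n x xs r) (extvec n x xs (r + 1)) : ℝ≥0∞)
      ∂(Measure.pi fun _ : Fin n => μ) = 1 := by
  induction n with
  | zero => intro g hg hi x; simp
  | succ n ih =>
    intro g hg hi x
    have mp := (measurePreserving_piFinSuccAbove (fun _ : Fin (n + 1) => μ) 0).symm
    rw [← mp.lintegral_comp_emb (MeasurableEquiv.measurableEmbedding _)]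
    have key : ∀ q : E × (Fin n → E),
        (∏ r ∈ Finset.range (n + 1),
          (g r (extvec (n + 1) x ((MeasurableEquiv.piFinSuccAbove (fun _ => E) 0).symm q) r)
            (extvec (n + 1) x ((MeasurableEquiv.piFinSuccAbove (fun _ => E) 0).symm q) (r + 1)) : ℝ≥0∞))
        = (g 0 x q.1 : ℝ≥0∞) * ∏ r ∈ Finset.range n,
          (g (r + 1) (extvec n q.1 q.2 r) (extvec n q.1 q.2 (r + 1)) : ℝ≥0∞) := by
      rintro ⟨y, xs⟩
      have e : (MeasurableEquiv.piFinSuccAbove (fun _ : Fin (n + 1) => E) 0).symm (y, xs)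
          = (Fin.cons y xs : Fin (n + 1) → E) := by
        simp [MeasurableEquiv.piFinSuccAbove]
        rfl
      rw [e, Finset.prod_range_succ', mul_comm]
      rw [extvec_cons n x y xs 0 (by omega), extvec_zero, extvec_zero]
      congr 1
      refine Finset.prod_congr rfl fun r hr => ?_
      have := Finset.mem_range.1 hr
      rw [extvec_cons n x y xs r (by omega), extvec_cons n x y xs (r + 1) (by omega)]
    simp_rw [key]
    have mterm : ∀ r, Measurable fun q : E × (Fin n → E) =>
        (g (r + 1) (extvec n q.1 q.2 r) (extvec n q.1 q.2 (r + 1)) : ℝ≥0∞) := fun r =>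
      ((hg (r + 1)).comp ((extvec_meas n r).prodMk (extvec_meas n (r + 1)))).coe_nnreal_ennreal
    have mprod : Measurable fun q : E × (Fin n → E) => ∏ r ∈ Finset.range n,
          (g (r + 1) (extvec n q.1 q.2 r) (extvec n q.1 q.2 (r + 1)) : ℝ≥0∞) :=
      Finset.measurable_fun_prod _ fun r _ => mterm r
    have m0 : Measurable fun q : E × (Fin n → E) => (g 0 x q.1 : ℝ≥0∞) :=
      ((hg 0).comp (measurable_const.prodMk measurable_fst)).coe_nnreal_ennreal
    refine (lintegral_prod _ (m0.mul mprod).aemeasurable).trans ?_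
    have : ∀ y, ∫⁻ xs, (g 0 x y : ℝ≥0∞) * ∏ r ∈ Finset.range n,
          (g (r + 1) (extvec n y xs r) (extvec n y xs (r + 1)) : ℝ≥0∞)
          ∂(Measure.pi fun _ : Fin n => μ) = g 0 x y := by
      intro y
      rw [lintegral_const_mul' _ _ ENNReal.coe_ne_top,
        ih (fun r => g (r + 1)) (fun r => hg _) (fun r => hi _) y, mul_one]
    refine Eq.trans ?_ (hi 0 x)
    exact lintegral_congr this

lemma Icc_prod_eq {M : Type*} [CommMonoid M] (F : ℕ → M) (a b : ℕ) :
    ∏ r ∈ Finset.Icc (a + 1) b, F r = ∏ r ∈ Finset.Ioc a b, F r := by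
  refine Finset.prod_congr ?_ fun _ _ => rfl
  ext j
  rw [Finset.mem_Icc, Finset.mem_Ioc]
  omega

lemma Lfn_zero_eq {E : Type*} (f0 f1 : E → E → ℝ≥0) (n m : ℕ) (xv : ℕ → E) :
    Lfn f0 f1 0 n m xv = ∏ r ∈ Finset.range n,
      (if r + 1 ≤ n - m then f0 else f1) (xv r) (xv (r + 1)) := by
  have h : ∏ r ∈ Finset.range n, (if r + 1 ≤ n - m then f0 else f1) (xv r) (xv (r + 1))
      = ∏ r ∈ Finset.Ioc 0 n, (if r ≤ n - m then f0 else f1) (xv (r - 1)) (xv r) := by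
    refine Finset.prod_nbij' (fun r => r + 1) (fun r => r - 1) ?_ ?_ ?_ ?_ ?_
    · intro r hr; simp only [Finset.mem_range, Finset.mem_Ioc] at *; omega
    · intro r hr; simp only [Finset.mem_range, Finset.mem_Ioc] at *; omega
    · intro r hr; omega
    · intro r hr; simp only [Finset.mem_Ioc] at hr; omega
    · intro r hr; rw [Nat.add_sub_cancel]
  rw [h, ← Finset.prod_Ioc_consecutive _ (Nat.zero_le (n - m)) (Nat.sub_le n m)]
  unfold Lfn
  rw [Icc_prod_eq, Icc_prod_eq]
  congr 1
  · refine Finset.prod_congr rfl fun r hr => ?_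
    rw [Finset.mem_Ioc] at hr
    rw [if_pos hr.2]
  · refine Finset.prod_congr rfl fun r hr => ?_
    rw [Finset.mem_Ioc] at hr
    rw [if_neg (by omega)]

lemma Lfn_split {E : Type*} (f0 f1 : E → E → ℝ≥0) (k n m : ℕ) (hk : k + m ≤ n) (xv : ℕ → E) :
    Lfn f0 f1 0 n m xv =
      (∏ r ∈ Finset.Ioc 0 k, f0 (xv (r - 1)) (xv r)) * Lfn f0 f1 k n m xv := by
  unfold Lfn
  rw [Icc_prod_eq, Icc_prod_eq, Icc_prod_eq, ← mul_assoc,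
    Finset.prod_Ioc_consecutive _ (Nat.zero_le k) (by omega)]

lemma Lfn_meas {E : Type*} [MeasurableSpace E] (f0 f1 : E → E → ℝ≥0)
    (hf0 : Measurable (Function.uncurry f0)) (hf1 : Measurable (Function.uncurry f1))
    (k n m : ℕ) (x : E) : Measurable fun xs : Fin n → E => Lfn f0 f1 k n m (extvec n x xs) := by
  unfold Lfn
  refine Measurable.mul ?_ ?_
  · exact Finset.measurable_fun_prod _ fun r _ =>
      hf0.comp ((extvec_meas' n x (r - 1)).prodMk (extvec_meas' n x r))
  · exact Finset.measurable_fun_prod _ fun r _ =>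
      hf1.comp ((extvec_meas' n x (r - 1)).prodMk (extvec_meas' n x r))

lemma Lfn_lintegral {E : Type*} [MeasurableSpace E] (μ : Measure E) [SigmaFinite μ]
    (f0 f1 : E → E → ℝ≥0)
    (hf0 : Measurable (Function.uncurry f0)) (hf1 : Measurable (Function.uncurry f1))
    (hi0 : ∀ z, ∫⁻ y, (f0 z y : ℝ≥0∞) ∂μ = 1) (hi1 : ∀ z, ∫⁻ y, (f1 z y : ℝ≥0∞) ∂μ = 1)
    (n m : ℕ) (x : E) :
    ∫⁻ xs, (Lfn f0 f1 0 n m (extvec n x xs) : ℝ≥0∞) ∂(Measure.pi fun _ : Fin n => μ) = 1 := by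
  simp_rw [Lfn_zero_eq, ENNReal.ofNNReal_finsetProd]
  apply path_lintegral μ n (fun r => if r + 1 ≤ n - m then f0 else f1)
  · intro r; split_ifs <;> assumption
  · intro r; split_ifs <;> assumption

lemma ell_meas {E : Type*} [MeasurableSpace E] (f0 f1 : E → E → ℝ≥0)
    (hf0 : Measurable (Function.uncurry f0)) (hf1 : Measurable (Function.uncurry f1))
    (n j : ℕ) (x : E) :
    Measurable fun xs : Fin n → E => (ellDens f0 f1 n j (extvec n x xs) : ℝ≥0∞) := by
  unfold ellDens
  split_ifs <;> exact (Lfn_meas f0 f1 hf0 hf1 _ _ _ x).coe_nnreal_ennreal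

lemma ell_lintegral {E : Type*} [MeasurableSpace E] (μ : Measure E) [SigmaFinite μ]
    (f0 f1 : E → E → ℝ≥0)
    (hf0 : Measurable (Function.uncurry f0)) (hf1 : Measurable (Function.uncurry f1))
    (hi0 : ∀ z, ∫⁻ y, (f0 z y : ℝ≥0∞) ∂μ = 1) (hi1 : ∀ z, ∫⁻ y, (f1 z y : ℝ≥0∞) ∂μ = 1)
    (n j : ℕ) (x : E) :
    ∫⁻ xs, (ellDens f0 f1 n j (extvec n x xs) : ℝ≥0∞) ∂(Measure.pi fun _ : Fin n => μ) = 1 := by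
  unfold ellDens
  split_ifs <;> exact Lfn_lintegral μ f0 f1 hf0 hf1 hi0 hi1 _ _ x

lemma nu_lintegral {E : Type*} [MeasurableSpace E] (μ : Measure E) [SigmaFinite μ]
    (f0 f1 : E → E → ℝ≥0)
    (hf0 : Measurable (Function.uncurry f0)) (hf1 : Measurable (Function.uncurry f1))
    (p π : ℝ) (x : E) (n : ℕ) (h : ℕ × (Fin n → E) → ℝ≥0∞) (hh : Measurable h) :
    ∫⁻ ω, h ω ∂(nuMeasure μ f0 f1 p π x n) =
      ∫⁻ xs, ∑' j, prior p π j * (ellDens f0 f1 n j (extvec n x xs) : ℝ≥0∞) * h (j, xs)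
        ∂(Measure.pi fun _ : Fin n => μ) := by
  have hm : ∀ j : ℕ, Measurable fun xs : Fin n → E => h (j, xs) := fun j =>
    hh.comp (measurable_const.prodMk measurable_id)
  have hl := fun j => ell_meas f0 f1 hf0 hf1 n j x
  have hlm : ∀ j, Measurable fun xs : Fin n → E =>
      prior p π j * (ellDens f0 f1 n j (extvec n x xs) : ℝ≥0∞) * h (j, xs) := fun j =>
    ((hl j).const_mul _).mul (hm j)
  rw [lintegral_tsum (fun j => (hlm j).aemeasurable)]
  unfold nuMeasure
  rw [lintegral_sum_measure]
  refine tsum_congr fun j => ?_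
  rw [lintegral_smul_measure, lintegral_map hh measurable_prodMk_left,
    lintegral_withDensity_eq_lintegral_mul _ (hl j) (hm j), smul_eq_mul,
    ← lintegral_const_mul _ ((hl j).mul (hm j))]
  refine lintegral_congr fun xs => ?_
  simp [mul_assoc]

lemma prior_tail {p π : ℝ} (hp : p ∈ Set.Ioo (0 : ℝ) 1) (hπ : π ∈ Set.Ioo (0 : ℝ) 1) (n : ℕ) :
    ∑' j, Set.indicator {j | n < j} (prior p π) j = ENNReal.ofReal ((1 - π) * p ^ n) := by
  obtain ⟨hp0, hp1⟩ := hp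
  obtain ⟨h0, h1⟩ := hπ
  have e : ∑' j, Set.indicator {j | n < j} (prior p π) j = ∑' i, prior p π (i + (n + 1)) := by
    rw [← (ENNReal.summable).sum_add_tsum_nat_add' (k := n + 1)]
    rw [Finset.sum_eq_zero, zero_add]
    · refine tsum_congr fun i => ?_
      rw [Set.indicator_of_mem]
      simp; omega
    · intro j hj
      rw [Set.indicator_of_notMem]
      have := Finset.mem_range.1 hj
      simp; omega
  have hs : HasSum (fun i : ℕ => (1 - π) * p ^ n * (1 - p) * p ^ i) ((1 - π) * p ^ n) := by
    have := (hasSum_geometric_of_lt_one hp0.le hp1).mul_left ((1 - π) * p ^ n * (1 - p))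
    rwa [mul_inv_cancel_right₀ (by linarith : 1 - p ≠ 0)] at this
  have q0 : 0 < 1 - p := by linarith
  have q1 : 0 < 1 - π := by linarith
  rw [e, ← hs.tsum_eq, ENNReal.ofReal_tsum_of_nonneg (fun i => by positivity) hs.summable]
  refine tsum_congr fun i => ?_
  unfold prior
  rw [if_neg (by omega)]
  congr 1
  rw [show i + (n + 1) - 1 = n + i by omega, pow_add]
  ring

lemma prior_finite {p π : ℝ} (hp : p ∈ Set.Ioo (0 : ℝ) 1) (hπ : π ∈ Set.Ioo (0 : ℝ) 1) :
    ∑' j, prior p π j < ⊤ := by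
  have := prior_tail hp hπ 0
  rw [← (ENNReal.summable).sum_add_tsum_nat_add' (k := 1)]
  rw [← (ENNReal.summable).sum_add_tsum_nat_add' (k := 1)] at this
  simp [Set.indicator] at this
  rw [this]
  simp [prior]

lemma nu_finite {E : Type*} [MeasurableSpace E] (μ : Measure E) [SigmaFinite μ]
    (f0 f1 : E → E → ℝ≥0)
    (hf0 : Measurable (Function.uncurry f0)) (hf1 : Measurable (Function.uncurry f1))
    (hi0 : ∀ z, ∫⁻ y, (f0 z y : ℝ≥0∞) ∂μ = 1) (hi1 : ∀ z, ∫⁻ y, (f1 z y : ℝ≥0∞) ∂μ = 1)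
    (p π : ℝ) (hp : p ∈ Set.Ioo (0 : ℝ) 1) (hπ : π ∈ Set.Ioo (0 : ℝ) 1)
    (n : ℕ) (x : E) : IsFiniteMeasure (nuMeasure μ f0 f1 p π x n) := by
  constructor
  have hl := fun j => ell_meas f0 f1 hf0 hf1 n j x
  rw [← lintegral_one, nu_lintegral μ f0 f1 hf0 hf1 _ _ _ _ _ measurable_const]
  simp_rw [mul_one]
  rw [lintegral_tsum (fun j => ((hl j).const_mul _).aemeasurable)]
  simp_rw [lintegral_const_mul _ (hl _), ell_lintegral μ f0 f1 hf0 hf1 hi0 hi1, mul_one]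
  exact prior_finite hp hπ

/-- The ratio factor. -/
noncomputable def Gfac {E : Type*} (f0 f1 : E → E → ℝ≥0) (p : ℝ) (n d₁ d₂ : ℕ) (xv : ℕ → E) : ℝ :=
  1 - p ^ d₂ + (1 - p) * ∑ m ∈ Finset.Icc 1 (d₁ + 1),
            (Lfn f0 f1 (n - d₁ - 1) n m xv : ℝ) /
              (p ^ m * (Lfn f0 f1 (n - d₁ - 1) n 0 xv : ℝ))

lemma Gfac_nonneg {E : Type*} (f0 f1 : E → E → ℝ≥0) {p : ℝ} (hp : p ∈ Set.Ioo (0 : ℝ) 1)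
    (n d₁ d₂ : ℕ) (xv : ℕ → E) : 0 ≤ Gfac f0 f1 p n d₁ d₂ xv := by
  obtain ⟨hp0, hp1⟩ := hp
  have q0 : 0 < 1 - p := by linarith
  have : p ^ d₂ ≤ 1 := pow_le_one₀ hp0.le hp1.le
  have : 0 ≤ 1 - p ^ d₂ := by linarith
  unfold Gfac
  positivity

lemma weights {E : Type*} (f0 f1 : E → E → ℝ≥0) (hpos : ∀ z y, 0 < f0 z y)
    {p π : ℝ} (hp : p ∈ Set.Ioo (0 : ℝ) 1) (hπ : π ∈ Set.Ioo (0 : ℝ) 1)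
    (n d₁ d₂ : ℕ) (hn : d₁ + 1 ≤ n) (xv : ℕ → E) :
    ∑' j, Set.indicator {j | n ≤ j + d₁ ∧ j ≤ n + d₂}
        (fun j => prior p π j * (ellDens f0 f1 n j xv : ℝ≥0∞)) j =
      ENNReal.ofReal (Gfac f0 f1 p n d₁ d₂ xv) * ∑' j, Set.indicator {j | n < j}
        (fun j => prior p π j * (ellDens f0 f1 n j xv : ℝ≥0∞)) j := by
  have hp' := hp
  have hπ' := hπ
  obtain ⟨hp0, hp1⟩ := hp
  obtain ⟨h0, h1⟩ := hπ
  have q0 : 0 < 1 - p := by linarith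
  have q1 : 0 < 1 - π := by linarith
  have hR : ∑' j, Set.indicator {j | n < j}
        (fun j => prior p π j * (ellDens f0 f1 n j xv : ℝ≥0∞)) j
      = ENNReal.ofReal ((1 - π) * p ^ n * (Lfn f0 f1 0 n 0 xv : ℝ)) := by
    rw [ENNReal.ofReal_mul (by positivity), ← prior_tail hp' hπ', ← ENNReal.tsum_mul_right]
    refine tsum_congr fun j => ?_
    by_cases hj : n < j
    · rw [Set.indicator_of_mem (by exact hj), Set.indicator_of_mem (by exact hj)]
      unfold ellDens
      rw [if_neg (by omega), if_neg (by omega), ENNReal.ofReal_coe_nnreal]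
    · rw [Set.indicator_of_notMem (by exact hj), Set.indicator_of_notMem (by exact hj), zero_mul]
  have hT : ∀ j, 1 ≤ j → prior p π j * (ellDens f0 f1 n j xv : ℝ≥0∞) =
      ENNReal.ofReal ((1 - π) * p ^ (j - 1) * (1 - p) * (ellDens f0 f1 n j xv : ℝ)) := by
    intro j hj
    rw [ENNReal.ofReal_mul (by positivity), ENNReal.ofReal_coe_nnreal]
    unfold prior
    rw [if_neg (by omega)]
  have hL : ∑' j, Set.indicator {j | n ≤ j + d₁ ∧ j ≤ n + d₂}
        (fun j => prior p π j * (ellDens f0 f1 n j xv : ℝ≥0∞)) j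
      = ENNReal.ofReal (∑ j ∈ Finset.Ico (n - d₁) (n + d₂ + 1),
        (1 - π) * p ^ (j - 1) * (1 - p) * (ellDens f0 f1 n j xv : ℝ)) := by
    rw [tsum_eq_sum (s := Finset.Ico (n - d₁) (n + d₂ + 1)),
      ENNReal.ofReal_sum_of_nonneg (fun _ _ => by positivity)]
    · refine Finset.sum_congr rfl fun j hj => ?_
      rw [Finset.mem_Ico] at hj
      rw [Set.indicator_of_mem, hT j (by omega)]
      simp; omega
    · intro j hj
      rw [Finset.mem_Ico] at hj
      rw [Set.indicator_of_notMem]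
      simp; omega
  rw [hR, hL, ← ENNReal.ofReal_mul (Gfac_nonneg f0 f1 hp' _ _ _ _)]
  congr 1
  rw [← Finset.sum_Ico_consecutive _ (show n - d₁ ≤ n + 1 by omega) (show n + 1 ≤ n + d₂ + 1 by omega)]
  have hB : ∑ j ∈ Finset.Ico (n + 1) (n + d₂ + 1),
        (1 - π) * p ^ (j - 1) * (1 - p) * (ellDens f0 f1 n j xv : ℝ)
      = (1 - p ^ d₂) * ((1 - π) * p ^ n * (Lfn f0 f1 0 n 0 xv : ℝ)) := by
    rw [Finset.sum_Ico_eq_sum_range, show n + d₂ + 1 - (n + 1) = d₂ by omega,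
      ← mul_neg_geom_sum p d₂, Finset.mul_sum, Finset.sum_mul]
    refine Finset.sum_congr rfl fun i _ => ?_
    unfold ellDens
    rw [if_neg (by omega), if_neg (by omega), show n + 1 + i - 1 = n + i by omega, pow_add]
    ring
  have hA : ∑ j ∈ Finset.Ico (n - d₁) (n + 1),
        (1 - π) * p ^ (j - 1) * (1 - p) * (ellDens f0 f1 n j xv : ℝ)
      = ((1 - p) * ∑ m ∈ Finset.Icc 1 (d₁ + 1),
            (Lfn f0 f1 (n - d₁ - 1) n m xv : ℝ) /
              (p ^ m * (Lfn f0 f1 (n - d₁ - 1) n 0 xv : ℝ))) *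
          ((1 - π) * p ^ n * (Lfn f0 f1 0 n 0 xv : ℝ)) := by
    rw [Finset.mul_sum, Finset.sum_mul]
    refine Finset.sum_nbij' (fun j => n + 1 - j) (fun m => n + 1 - m) ?_ ?_ ?_ ?_ ?_
    · intro j hj; simp only [Finset.mem_Ico, Finset.mem_Icc] at *; omega
    · intro j hj; simp only [Finset.mem_Ico, Finset.mem_Icc] at *; omega
    · intro j hj; simp only [Finset.mem_Ico, Finset.mem_Icc] at *; omega
    · intro j hj; simp only [Finset.mem_Ico, Finset.mem_Icc] at *; omega
    · intro j hj
      simp only [Finset.mem_Ico] at hj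
      have e : ellDens f0 f1 n j xv = Lfn f0 f1 0 n (n + 1 - j) xv := by
        unfold ellDens
        rw [if_neg (by omega), if_pos (by omega), show n - j + 1 = n + 1 - j by omega]
      rw [e, Lfn_split f0 f1 (n - d₁ - 1) n (n + 1 - j) (by omega),
        Lfn_split f0 f1 (n - d₁ - 1) n 0 (by omega)]
      have hL0 : (Lfn f0 f1 (n - d₁ - 1) n 0 xv : ℝ) ≠ 0 := by
        have : 0 < Lfn f0 f1 (n - d₁ - 1) n 0 xv := by
          unfold Lfn
          refine mul_pos (Finset.prod_pos fun _ _ => hpos _ _) ?_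
          simp
        exact_mod_cast this.ne'
      have hpn : p ^ n = p ^ (j - 1) * p ^ (n + 1 - j) := by
        rw [← pow_add]; congr 1; omega
      have hpm : p ^ (n + 1 - j) ≠ 0 := by positivity
      rw [hpn]
      push_cast
      field_simp
  rw [hA, hB]
  unfold Gfac
  ring

lemma slice_lintegral {E : Type*} [MeasurableSpace E] (μ : Measure E) [SigmaFinite μ]
    (f0 f1 : E → E → ℝ≥0)
    (hf0 : Measurable (Function.uncurry f0)) (hf1 : Measurable (Function.uncurry f1))
    (p π : ℝ) (x : E) (n : ℕ) (A : Set ℕ) (S : Set (Fin n → E)) (hS : MeasurableSet S)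
    (h : (Fin n → E) → ℝ) (hh : Measurable h) :
    ∫⁻ ω in Prod.snd ⁻¹' S, ENNReal.ofReal (Set.indicator {ω : ℕ × (Fin n → E) | ω.1 ∈ A}
        (fun ω => h ω.2) ω) ∂(nuMeasure μ f0 f1 p π x n) =
      ∫⁻ xs in S, ENNReal.ofReal (h xs) * ∑' j, Set.indicator A
        (fun j => prior p π j * (ellDens f0 f1 n j (extvec n x xs) : ℝ≥0∞)) j
        ∂(Measure.pi fun _ : Fin n => μ) := by
  have hA : MeasurableSet {ω : ℕ × (Fin n → E) | ω.1 ∈ A} :=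
    measurable_fst (MeasurableSet.of_discrete (s := A))
  rw [← lintegral_indicator (measurable_snd hS), ← lintegral_indicator hS,
    nu_lintegral μ f0 f1 hf0 hf1]
  · refine lintegral_congr fun xs => ?_
    by_cases hx : xs ∈ S
    · rw [Set.indicator_of_mem hx, ← ENNReal.tsum_mul_left]
      refine tsum_congr fun j => ?_
      rw [Set.indicator_of_mem (by exact hx)]
      by_cases hj : j ∈ A
      · rw [Set.indicator_of_mem (by exact hj), Set.indicator_of_mem hj, mul_comm]
      · rw [Set.indicator_of_notMem (by exact hj), Set.indicator_of_notMem hj]; simp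
    · rw [Set.indicator_of_notMem hx]
      simp [Set.indicator, hx]
  · exact (((hh.comp measurable_snd).indicator hA).ennreal_ofReal).indicator (measurable_snd hS)

/-- Payoff transformation: for `n ≥ d₁ + 1`, `ν`-a.e.
`ν(n - d₁ ≤ θ ≤ n + d₂ | 𝓕_n)
  = (1 - Π_n)(1 - p^{d₂} + q ∑_{m=1}^{d₁+1} L_m(X_{n-d₁-1},…,X_n)/(p^m L₀(X_{n-d₁-1},…,X_n)))`,
where `Π_n = ν(θ ≤ n | 𝓕_n)`. -/
theorem stmt12 {E : Type*} [MeasurableSpace E] (μ : Measure E) [SigmaFinite μ]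
    (f0 f1 : E → E → ℝ≥0) (hf0 : Measurable (Function.uncurry f0))
    (hf1 : Measurable (Function.uncurry f1)) (hpos : ∀ z y, 0 < f0 z y)
    (hi0 : ∀ z, ∫⁻ y, (f0 z y : ℝ≥0∞) ∂μ = 1) (hi1 : ∀ z, ∫⁻ y, (f1 z y : ℝ≥0∞) ∂μ = 1)
    (p π : ℝ) (hp : p ∈ Set.Ioo (0 : ℝ) 1) (hπ : π ∈ Set.Ioo (0 : ℝ) 1)
    (x : E) (n d₁ d₂ : ℕ) (hn : d₁ + 1 ≤ n) :
    ∀ᵐ ω ∂(nuMeasure μ f0 f1 p π x n),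
      ((nuMeasure μ f0 f1 p π x n)[Set.indicator
          {ω' : ℕ × (Fin n → E) | n ≤ ω'.1 + d₁ ∧ ω'.1 ≤ n + d₂} (fun _ => (1 : ℝ)) |
          Ffil n n le_rfl]) ω =
        (1 - ((nuMeasure μ f0 f1 p π x n)[Set.indicator {ω' : ℕ × (Fin n → E) | ω'.1 ≤ n}
            (fun _ => (1 : ℝ)) | Ffil n n le_rfl]) ω) *
          (1 - p ^ d₂ + (1 - p) * ∑ m ∈ Finset.Icc 1 (d₁ + 1),
            (Lfn f0 f1 (n - d₁ - 1) n m (extvec n x ω.2) : ℝ) /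
              (p ^ m * (Lfn f0 f1 (n - d₁ - 1) n 0 (extvec n x ω.2) : ℝ))) := by
  have hfin := nu_finite μ f0 f1 hf0 hf1 hi0 hi1 p π hp hπ n x
  set ν := nuMeasure μ f0 f1 p π x n with hν
  have hF : Ffil n n le_rfl =
      MeasurableSpace.comap (Prod.snd : ℕ × (Fin n → E) → (Fin n → E)) inferInstance := rfl
  have hle : Ffil (E := E) n n le_rfl ≤ (inferInstance : MeasurableSpace (ℕ × (Fin n → E))) := by
    rw [hF]; exact measurable_snd.comap_le
  let A : Set ℕ := {j | n ≤ j + d₁ ∧ j ≤ n + d₂}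
  let B : Set ℕ := {j | n < j}
  let G : (Fin n → E) → ℝ := fun xs => Gfac f0 f1 p n d₁ d₂ (extvec n x xs)
  have hGm : Measurable G := by
    have hL := fun m => (Lfn_meas f0 f1 hf0 hf1 (n - d₁ - 1) n m x).coe_nnreal_real
    refine Measurable.add measurable_const (Measurable.mul measurable_const ?_)
    exact Finset.measurable_fun_sum _ fun m _ => (hL m).div (measurable_const.mul (hL 0))
  have hG0 : ∀ xs, 0 ≤ G xs := fun xs => Gfac_nonneg f0 f1 hp _ _ _ _
  have mset : ∀ C : Set ℕ, MeasurableSet {ω : ℕ × (Fin n → E) | ω.1 ∈ C} := fun C =>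
    measurable_fst (MeasurableSet.of_discrete (s := C))
  let a : ℕ × (Fin n → E) → ℝ := Set.indicator {ω | ω.1 ∈ A} (fun _ => (1 : ℝ))
  let b : ℕ × (Fin n → E) → ℝ := Set.indicator {ω | ω.1 ∈ B} (fun _ => (1 : ℝ))
  let c : ℕ × (Fin n → E) → ℝ := Set.indicator {ω | ω.1 ≤ n} (fun _ => (1 : ℝ))
  let bg : ℕ × (Fin n → E) → ℝ := Set.indicator {ω | ω.1 ∈ B} (fun ω => G ω.2)
  have ia : Integrable a ν := (integrable_const _).indicator (mset A)
  have ib : Integrable b ν := (integrable_const _).indicator (mset B)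
  have ic : Integrable c ν := (integrable_const _).indicator (mset {j | j ≤ n})
  have mbg : Measurable bg := (hGm.comp measurable_snd).indicator (mset B)
  have a0 : ∀ ω, 0 ≤ a ω := fun ω => Set.indicator_nonneg (fun _ _ => zero_le_one) _
  have bg0 : ∀ ω, 0 ≤ bg ω := fun ω => Set.indicator_nonneg (fun _ _ => hG0 _) _
  have key : ∀ S : Set (Fin n → E), MeasurableSet S →
      ∫⁻ ω in Prod.snd ⁻¹' S, ENNReal.ofReal (bg ω) ∂ν =
        ∫⁻ ω in Prod.snd ⁻¹' S, ENNReal.ofReal (a ω) ∂ν := by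
    intro S hS
    refine (slice_lintegral μ f0 f1 hf0 hf1 p π x n B S hS G hGm).trans ?_
    refine Eq.trans ?_
      (slice_lintegral μ f0 f1 hf0 hf1 p π x n A S hS (fun _ => 1) measurable_const).symm
    refine lintegral_congr fun xs => ?_
    rw [ENNReal.ofReal_one, one_mul]
    exact (weights f0 f1 hpos hp hπ n d₁ d₂ hn (extvec n x xs)).symm
  have ibg : Integrable bg ν := by
    refine ⟨mbg.aestronglyMeasurable, ?_⟩
    rw [hasFiniteIntegral_iff_ofReal (Filter.Eventually.of_forall bg0)]
    have := key Set.univ MeasurableSet.univ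
    simp only [Set.preimage_univ, Measure.restrict_univ] at this
    rw [this, ← hasFiniteIntegral_iff_ofReal (Filter.Eventually.of_forall a0)]
    exact ia.2
  have E1 : ν[bg | Ffil n n le_rfl] =ᵐ[ν] ν[a | Ffil n n le_rfl] := by
    refine ae_eq_condExp_of_forall_setIntegral_eq hle ia
      (fun s _ _ => integrable_condExp.integrableOn) ?_
      stronglyMeasurable_condExp.aestronglyMeasurable
    intro s hs _
    rw [setIntegral_condExp hle ibg hs]
    obtain ⟨S, hS, rfl⟩ := hs
    rw [integral_eq_lintegral_of_nonneg_ae (Filter.Eventually.of_forall bg0)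
      mbg.aestronglyMeasurable,
      integral_eq_lintegral_of_nonneg_ae (Filter.Eventually.of_forall a0)
      ia.1.restrict]
    exact congrArg _ (key S hS)
  have hbg : bg = b * fun ω => G ω.2 := by
    funext ω
    by_cases hω : ω.1 ∈ B
    · simp [bg, b, Set.indicator, hω]
    · simp [bg, b, Set.indicator, hω]
  have Gsm : StronglyMeasurable[Ffil n n le_rfl] (fun ω : ℕ × (Fin n → E) => G ω.2) := by
    have : Measurable[Ffil n n le_rfl] (fun ω : ℕ × (Fin n → E) => G ω.2) := by
      rw [hF]; exact hGm.comp (comap_measurable _)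
    exact this.stronglyMeasurable
  have E2 : ν[bg | Ffil n n le_rfl] =ᵐ[ν] ν[b | Ffil n n le_rfl] * fun ω => G ω.2 := by
    rw [hbg]
    exact condExp_mul_of_stronglyMeasurable_right Gsm (hbg ▸ ibg) ib
  have hb : b = (fun _ => (1 : ℝ)) - c := by
    funext ω
    by_cases hω : ω.1 ≤ n
    · simp [b, c, B, Set.indicator, hω]
    · simp [b, c, B, Set.indicator, hω, not_le.1 hω]
  have E3 : ν[b | Ffil n n le_rfl] =ᵐ[ν] (fun _ => (1 : ℝ)) - ν[c | Ffil n n le_rfl] := by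
    have := condExp_sub (μ := ν) (integrable_const (1 : ℝ)) ic (Ffil n n le_rfl)
    rw [condExp_const hle] at this
    rw [hb]; exact this
  filter_upwards [E1, E2, E3] with ω e1 e2 e3
  change (ν[a | Ffil n n le_rfl]) ω = (1 - (ν[c | Ffil n n le_rfl]) ω) * G ω.2
  rw [← e1, e2, Pi.mul_apply, e3]
  rfl
end

section
/- Conditional law of the next observation: in the change-point model below with horizon n + 1, for every bounded measurable u : E → ℝ, ν-almost everywhere E_ν[u(X_{n+1}) | 𝓕_n] = ∫_E u(y) (p (1 − Π_n) f⁰(X_n, y) + (q + p Π_n) f¹(X_n, y)) μ(dy) = ∫_E u(y) G₁(X_n, y, Π_n) μ(dy), where Π_n := ν(θ ≤ n | 𝓕_n) and G₁(z, y, α) = α f¹(z, y) + (1 − α)(q f¹(z, y) + p f⁰(z, y)). -/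
open MeasureTheory Finset
open scoped NNReal ENNReal

open MeasureTheory

/-- `G₁(z, y, α) = α f¹(z,y) + (1-α)(q f¹(z,y) + p f⁰(z,y))`. -/
noncomputable def G1fn {E : Type*} (f0 f1 : E → E → ℝ≥0) (p : ℝ) (z y : E) (α : ℝ) : ℝ :=
  α * (f1 z y : ℝ) + (1 - α) * ((1 - p) * (f1 z y : ℝ) + p * (f0 z y : ℝ))

open ProbabilityTheory

section helpers

variable {E : Type*}

/-- the transition density used for the step leading to time `n+1` if `θ = j`. -/
def stepD (f0 f1 : E → E → ℝ≥0) (n j : ℕ) (z y : E) : ℝ≥0 :=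
  if j ≤ n + 1 then f1 z y else f0 z y

lemma ellDens_succ (f0 f1 : E → E → ℝ≥0) (n j : ℕ) (xv : ℕ → E) :
    ellDens f0 f1 (n + 1) j xv =
      ellDens f0 f1 n j xv * stepD f0 f1 n j (xv n) (xv (n + 1)) := by
  unfold ellDens Lfn stepD
  rcases Nat.eq_zero_or_pos j with rfl | hj
  · simp [Finset.prod_Icc_succ_top]
  have hj0 : j ≠ 0 := by omega
  simp only [hj0, if_false]
  rcases lt_trichotomy j (n + 1) with h | h | h
  · have h1 : j ≤ n := by omega
    have h2 : j ≤ n + 1 := by omega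
    have e1 : n + 1 - (n + 1 - j + 1) = j - 1 := by omega
    have e2 : n - (n - j + 1) = j - 1 := by omega
    simp only [h1, h2, if_true, e1, e2]
    rw [Finset.prod_Icc_succ_top (by omega : j - 1 + 1 ≤ n + 1), Nat.add_sub_cancel, mul_assoc]
  · subst h
    simp
  · have h1 : ¬ j ≤ n := by omega
    have h2 : ¬ j ≤ n + 1 := by omega
    simp only [h1, h2, if_false]
    rw [Nat.sub_zero, Nat.sub_zero, Finset.prod_Icc_succ_top (by omega : 0 + 1 ≤ n + 1)]
    simp

lemma ellDens_zero (f0 f1 : E → E → ℝ≥0) (j : ℕ) (xv : ℕ → E) :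
    ellDens f0 f1 0 j xv = 1 := by
  unfold ellDens Lfn
  by_cases hj : j = 0
  · simp [hj]
  · simp [hj]

lemma ellDens_congr (f0 f1 : E → E → ℝ≥0) (n j : ℕ) (xv yv : ℕ → E)
    (h : ∀ r ≤ n, xv r = yv r) :
    ellDens f0 f1 n j xv = ellDens f0 f1 n j yv := by
  induction n with
  | zero => rw [ellDens_zero, ellDens_zero]
  | succ n ih =>
    rw [ellDens_succ, ellDens_succ, ih (fun r hr => h r (by omega)), h n (by omega),
      h (n + 1) le_rfl]

/-- For `j > n` the density does not depend on `j`. -/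
lemma ellDens_gt (f0 f1 : E → E → ℝ≥0) (n j : ℕ) (hj : n < j) (xv : ℕ → E) :
    ellDens f0 f1 n j xv = ellDens f0 f1 n (n + 1) xv := by
  unfold ellDens
  have h1 : j ≠ 0 := by omega
  have h2 : ¬ j ≤ n := by omega
  simp [h1, h2]

/-- first `n` observations -/
def firstv (n : ℕ) (xs : Fin (n + 1) → E) : Fin n → E :=
  fun i => xs (Fin.castLE (Nat.le_succ n) i)

lemma extvec_first (n : ℕ) (x : E) (xs : Fin (n + 1) → E) (r : ℕ) (hr : r ≤ n) :
    extvec (n + 1) x xs r = extvec n x (firstv n xs) r := by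
  unfold extvec firstv
  by_cases h : 1 ≤ r
  · rw [dif_pos ⟨h, by omega⟩, dif_pos ⟨h, hr⟩]
    rfl
  · rw [dif_neg (by omega), dif_neg (by omega)]

lemma extvec_last (n : ℕ) (x : E) (xs : Fin (n + 1) → E) :
    extvec (n + 1) x xs (n + 1) = xs (Fin.last n) := by
  unfold extvec
  rw [dif_pos ⟨by omega, le_rfl⟩]
  rfl

lemma ellDens_step (f0 f1 : E → E → ℝ≥0) (n j : ℕ) (x : E) (xs : Fin (n + 1) → E) :
    ellDens f0 f1 (n + 1) j (extvec (n + 1) x xs) =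
      ellDens f0 f1 n j (extvec n x (firstv n xs)) *
        stepD f0 f1 n j (extvec n x (firstv n xs) n) (xs (Fin.last n)) := by
  rw [ellDens_succ, extvec_last, extvec_first n x xs n le_rfl,
    ellDens_congr f0 f1 n j _ _ (fun r hr => extvec_first n x xs r hr)]

variable [MeasurableSpace E]

@[fun_prop]
lemma measurable_extvec (n : ℕ) (x : E) (r : ℕ) :
    Measurable (fun xs : Fin n → E => extvec n x xs r) := by
  unfold extvec
  by_cases h : 1 ≤ r ∧ r ≤ n
  · simp only [h, and_self, dif_pos]
    fun_prop
  · simp only [h, dif_neg, not_false_eq_true]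
    fun_prop

@[fun_prop]
lemma measurable_firstv (n : ℕ) : Measurable (firstv n : (Fin (n + 1) → E) → (Fin n → E)) := by
  unfold firstv
  fun_prop

lemma measurable_stepD (f0 f1 : E → E → ℝ≥0) (hf0 : Measurable (Function.uncurry f0))
    (hf1 : Measurable (Function.uncurry f1)) (n j : ℕ) :
    Measurable (Function.uncurry (stepD f0 f1 n j)) := by
  unfold stepD
  by_cases h : j ≤ n + 1
  · simpa [h] using hf1
  · simpa [h] using hf0

lemma measurable_ellDens (f0 f1 : E → E → ℝ≥0) (hf0 : Measurable (Function.uncurry f0))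
    (hf1 : Measurable (Function.uncurry f1)) (n j : ℕ) (x : E) :
    Measurable (fun xs : Fin n → E => ellDens f0 f1 n j (extvec n x xs)) := by
  induction n with
  | zero => simp only [ellDens_zero]; fun_prop
  | succ n ih =>
    simp only [ellDens_step]
    refine (ih.comp (measurable_firstv n)).mul ?_
    exact (measurable_stepD f0 f1 hf0 hf1 n j).comp
      (((measurable_extvec n x n).comp (measurable_firstv n)).prodMk (measurable_pi_apply _))

/-- density of the next observation given `(θ, X₁, …, X_n)` -/
def nextD (f0 f1 : E → E → ℝ≥0) (n : ℕ) (x : E) (w : ℕ × (Fin n → E)) (y : E) : ℝ≥0 :=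
  stepD f0 f1 n w.1 (extvec n x w.2 n) y

lemma measurable_nextD (f0 f1 : E → E → ℝ≥0) (hf0 : Measurable (Function.uncurry f0))
    (hf1 : Measurable (Function.uncurry f1)) (n : ℕ) (x : E) :
    Measurable (Function.uncurry (nextD f0 f1 n x)) := by
  have h : Function.uncurry (nextD f0 f1 n x) = fun w : (ℕ × (Fin n → E)) × E =>
      if w.1.1 ≤ n + 1 then Function.uncurry f1 (extvec n x w.1.2 n, w.2)
      else Function.uncurry f0 (extvec n x w.1.2 n, w.2) := by
    funext w
    rfl
  rw [h]
  have hm : Measurable (fun w : (ℕ × (Fin n → E)) × E => (extvec n x w.1.2 n, w.2)) :=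
    ((measurable_extvec n x n).comp (measurable_snd.comp measurable_fst)).prodMk measurable_snd
  refine Measurable.ite ?_ (hf1.comp hm) (hf0.comp hm)
  exact (measurable_fst.comp measurable_fst) (measurableSet_Iic (a := n + 1))

lemma lintegral_nu (μ : Measure E) (f0 f1 : E → E → ℝ≥0)
    (hf0 : Measurable (Function.uncurry f0))
    (hf1 : Measurable (Function.uncurry f1)) (p π : ℝ) (x : E) (n : ℕ)
    (h : ℕ × (Fin n → E) → ℝ≥0∞) (hh : Measurable h) :
    ∫⁻ w, h w ∂(nuMeasure μ f0 f1 p π x n) =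
      ∑' j, prior p π j * ∫⁻ xs, (ellDens f0 f1 n j (extvec n x xs) : ℝ≥0∞) * h (j, xs)
        ∂(Measure.pi fun _ : Fin n => μ) := by
  unfold nuMeasure
  rw [lintegral_sum_measure]
  congr 1
  funext j
  rw [lintegral_smul_measure, lintegral_map hh (by fun_prop),
    lintegral_withDensity_eq_lintegral_mul _ (measurable_ellDens f0 f1 hf0 hf1 n j x).coe_nnreal_ennreal
      (by fun_prop)]
  rfl

lemma lintegral_pi_succ (μ : Measure E) [SigmaFinite μ] (n : ℕ)
    (g : (Fin n → E) × E → ℝ≥0∞) (hg : Measurable g) :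
    ∫⁻ xs, g (firstv n xs, xs (Fin.last n)) ∂(Measure.pi fun _ : Fin (n + 1) => μ) =
      ∫⁻ xs, ∫⁻ y, g (xs, y) ∂μ ∂(Measure.pi fun _ : Fin n => μ) := by
  have hmp := measurePreserving_piFinSuccAbove (fun _ : Fin (n + 1) => μ) (Fin.last n)
  have := hmp.lintegral_comp (f := fun z => g (z.2, z.1)) (by fun_prop)
  rw [lintegral_prod_symm _ (by fun_prop)] at this
  rw [← this]
  congr 1
  funext xs
  congr 2
  funext i
  simp [firstv, MeasurableEquiv.piFinSuccAbove, Fin.insertNthEquiv]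
  rfl

lemma lintegral_nu_succ (μ : Measure E) [SigmaFinite μ] (f0 f1 : E → E → ℝ≥0)
    (hf0 : Measurable (Function.uncurry f0))
    (hf1 : Measurable (Function.uncurry f1)) (p π : ℝ) (x : E) (n : ℕ)
    (h : (ℕ × (Fin n → E)) × E → ℝ≥0∞) (hh : Measurable h) :
    ∫⁻ w, h ((w.1, firstv n w.2), w.2 (Fin.last n)) ∂(nuMeasure μ f0 f1 p π x (n + 1)) =
      ∫⁻ w, ∫⁻ y, (nextD f0 f1 n x w y : ℝ≥0∞) * h (w, y) ∂μ ∂(nuMeasure μ f0 f1 p π x n) := by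
  have hD := measurable_nextD f0 f1 hf0 hf1 n x
  have hI : Measurable (fun w => ∫⁻ y, (nextD f0 f1 n x w y : ℝ≥0∞) * h (w, y) ∂μ) :=
    Measurable.lintegral_prod_right' (f := fun z : (ℕ × (Fin n → E)) × E =>
        ((Function.uncurry (nextD f0 f1 n x) z : ℝ≥0) : ℝ≥0∞) * h z) (by fun_prop)
  rw [lintegral_nu μ f0 f1 hf0 hf1 p π x (n + 1) _ (by fun_prop),
    lintegral_nu μ f0 f1 hf0 hf1 p π x n _ hI]
  congr 1
  funext j
  congr 1
  have hl := measurable_ellDens f0 f1 hf0 hf1 n j x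
  have hDj : Measurable (fun z : (Fin n → E) × E =>
      ((Function.uncurry (nextD f0 f1 n x) ((j, z.1), z.2) : ℝ≥0) : ℝ≥0∞)) := by fun_prop
  have hm := lintegral_pi_succ μ n (fun z => (ellDens f0 f1 n j (extvec n x z.1) : ℝ≥0∞) *
    (((Function.uncurry (nextD f0 f1 n x) ((j, z.1), z.2) : ℝ≥0) : ℝ≥0∞) * h ((j, z.1), z.2)))
    ((hl.comp measurable_fst).coe_nnreal_ennreal.mul (hDj.mul (by fun_prop)))
  have e1 : ∀ xs : Fin (n + 1) → E,
      (ellDens f0 f1 (n + 1) j (extvec (n + 1) x xs) : ℝ≥0∞) *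
        h ((j, firstv n xs), xs (Fin.last n)) =
      (ellDens f0 f1 n j (extvec n x (firstv n xs)) : ℝ≥0∞) *
        (((Function.uncurry (nextD f0 f1 n x) ((j, firstv n xs), xs (Fin.last n)) : ℝ≥0) : ℝ≥0∞)
          * h ((j, firstv n xs), xs (Fin.last n))) := by
    intro xs
    rw [ellDens_step, ENNReal.coe_mul, mul_assoc]
    rfl
  simp only [e1]
  rw [hm]
  congr 1
  funext xs
  exact lintegral_const_mul (μ := μ) (ellDens f0 f1 n j (extvec n x xs) : ℝ≥0∞) (f := fun y =>
    ((Function.uncurry (nextD f0 f1 n x) ((j, xs), y) : ℝ≥0) : ℝ≥0∞) * h ((j, xs), y))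
    (by fun_prop)

lemma lintegral_nextD (μ : Measure E) (f0 f1 : E → E → ℝ≥0)
    (hi0 : ∀ z, ∫⁻ y, (f0 z y : ℝ≥0∞) ∂μ = 1) (hi1 : ∀ z, ∫⁻ y, (f1 z y : ℝ≥0∞) ∂μ = 1)
    (n : ℕ) (x : E) (w : ℕ × (Fin n → E)) :
    ∫⁻ y, (nextD f0 f1 n x w y : ℝ≥0∞) ∂μ = 1 := by
  unfold nextD stepD
  by_cases h : w.1 ≤ n + 1
  · simp [h, hi1]
  · simp [h, hi0]

lemma prior_succ (p π : ℝ) (hp : p ∈ Set.Ioo (0 : ℝ) 1) (hπ : π ∈ Set.Ioo (0 : ℝ) 1) (j : ℕ) :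
    (prior p π (j + 1)).toReal = (1 - π) * (1 - p) * p ^ j := by
  unfold prior
  have h1 : 0 ≤ 1 - π := by linarith [hπ.2]
  have h2 : 0 ≤ 1 - p := by linarith [hp.2]
  have h3 : 0 ≤ p := hp.1.le
  rw [if_neg (by omega), ENNReal.toReal_ofReal (by positivity), Nat.add_sub_cancel]
  ring

lemma prior_ne_top (p π : ℝ) (j : ℕ) : prior p π j ≠ ∞ := by
  unfold prior
  split_ifs <;> exact ENNReal.ofReal_ne_top

lemma tsum_prior_ne_top (p π : ℝ) (hp : p ∈ Set.Ioo (0 : ℝ) 1) (hπ : π ∈ Set.Ioo (0 : ℝ) 1) :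
    ∑' j, prior p π j ≠ ∞ := by
  have hs : Summable (fun j => (prior p π j).toReal) := by
    rw [← summable_nat_add_iff 1]
    simp only [prior_succ p π hp hπ]
    exact (summable_geometric_of_lt_one hp.1.le hp.2).mul_left _
  have := hs.tsum_ofReal_ne_top
  simpa [ENNReal.ofReal_toReal (prior_ne_top p π _)] using this

lemma isFinite_nu (μ : Measure E) [SigmaFinite μ] (f0 f1 : E → E → ℝ≥0)
    (hf0 : Measurable (Function.uncurry f0))
    (hf1 : Measurable (Function.uncurry f1))
    (hi0 : ∀ z, ∫⁻ y, (f0 z y : ℝ≥0∞) ∂μ = 1) (hi1 : ∀ z, ∫⁻ y, (f1 z y : ℝ≥0∞) ∂μ = 1)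
    (p π : ℝ) (hp : p ∈ Set.Ioo (0 : ℝ) 1) (hπ : π ∈ Set.Ioo (0 : ℝ) 1) (x : E) (n : ℕ) :
    IsFiniteMeasure (nuMeasure μ f0 f1 p π x n) := by
  induction n with
  | zero =>
    constructor
    have := lintegral_nu μ f0 f1 hf0 hf1 p π x 0 (fun _ => 1) measurable_const
    rw [lintegral_one] at this
    rw [this]
    simp only [ellDens_zero]
    simpa using (tsum_prior_ne_top p π hp hπ).lt_top
  | succ n ih =>
    constructor
    have := lintegral_nu_succ μ f0 f1 hf0 hf1 p π x n (fun _ => 1) measurable_const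
    rw [lintegral_one] at this
    rw [this]
    simp only [mul_one, lintegral_nextD μ f0 f1 hi0 hi1 n x, lintegral_one]
    exact measure_lt_top _ _

/-- Kernel of the next observation. -/
noncomputable def nextK (μ : Measure E) [SigmaFinite μ] (f0 f1 : E → E → ℝ≥0) (n : ℕ) (x : E) :
    Kernel (ℕ × (Fin n → E)) E :=
  Kernel.withDensity (Kernel.const _ μ) (fun w y => (nextD f0 f1 n x w y : ℝ≥0∞))

lemma isMarkov_nextK (μ : Measure E) [SigmaFinite μ] (f0 f1 : E → E → ℝ≥0)
    (hf0 : Measurable (Function.uncurry f0))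
    (hf1 : Measurable (Function.uncurry f1))
    (hi0 : ∀ z, ∫⁻ y, (f0 z y : ℝ≥0∞) ∂μ = 1) (hi1 : ∀ z, ∫⁻ y, (f1 z y : ℝ≥0∞) ∂μ = 1)
    (n : ℕ) (x : E) : IsMarkovKernel (nextK μ f0 f1 n x) := by
  constructor
  intro w
  constructor
  rw [nextK, Kernel.withDensity_apply' _ (measurable_nextD f0 f1 hf0 hf1 n x).coe_nnreal_ennreal]
  simp [lintegral_nextD μ f0 f1 hi0 hi1 n x]

/-- splitting of the trajectory -/
def splitv (n : ℕ) (w : ℕ × (Fin (n + 1) → E)) : (ℕ × (Fin n → E)) × E :=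
  ((w.1, firstv n w.2), w.2 (Fin.last n))

@[fun_prop]
lemma measurable_splitv (n : ℕ) :
    Measurable (splitv n : ℕ × (Fin (n + 1) → E) → (ℕ × (Fin n → E)) × E) := by
  unfold splitv
  fun_prop

lemma map_nu (μ : Measure E) [SigmaFinite μ] (f0 f1 : E → E → ℝ≥0)
    (hf0 : Measurable (Function.uncurry f0))
    (hf1 : Measurable (Function.uncurry f1))
    (hi0 : ∀ z, ∫⁻ y, (f0 z y : ℝ≥0∞) ∂μ = 1) (hi1 : ∀ z, ∫⁻ y, (f1 z y : ℝ≥0∞) ∂μ = 1)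
    (p π : ℝ) (hp : p ∈ Set.Ioo (0 : ℝ) 1) (hπ : π ∈ Set.Ioo (0 : ℝ) 1) (x : E) (n : ℕ) :
    (nuMeasure μ f0 f1 p π x (n + 1)).map (splitv n) =
      (nuMeasure μ f0 f1 p π x n).compProd (nextK μ f0 f1 n x) := by
  have := isFinite_nu μ f0 f1 hf0 hf1 hi0 hi1 p π hp hπ x n
  have := isMarkov_nextK μ f0 f1 hf0 hf1 hi0 hi1 n x
  refine Measure.ext_of_lintegral _ fun h hh => ?_
  rw [lintegral_map hh (by fun_prop), Measure.lintegral_compProd hh]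
  refine (lintegral_nu_succ μ f0 f1 hf0 hf1 p π x n h hh).trans ?_
  congr 1
  funext w
  rw [nextK, Kernel.lintegral_withDensity _
    (measurable_nextD f0 f1 hf0 hf1 n x).coe_nnreal_ennreal _ (by fun_prop)]
  simp

lemma hasSum_conv {f g : ℕ → ℝ} {a b : ℝ} (h : HasSum f a) (h1 : ∀ i, g i = f i) (h2 : b = a) :
    HasSum g b := by
  rw [h2, funext h1]
  exact h

lemma hasSum_integral_nu (μ : Measure E) (f0 f1 : E → E → ℝ≥0)
    (hf0 : Measurable (Function.uncurry f0))
    (hf1 : Measurable (Function.uncurry f1)) (p π : ℝ) (x : E) (n : ℕ)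
    (F : ℕ × (Fin n → E) → ℝ) (hF : Measurable F)
    (hint : Integrable F (nuMeasure μ f0 f1 p π x n)) :
    HasSum (fun j => (prior p π j).toReal *
      ∫ xs, (ellDens f0 f1 n j (extvec n x xs) : ℝ) * F (j, xs) ∂(Measure.pi fun _ : Fin n => μ))
      (∫ w, F w ∂(nuMeasure μ f0 f1 p π x n)) := by
  have h := hasSum_integral_measure (f := F) (μ := fun j => prior p π j •
      Measure.map (fun xs => (j, xs))
        ((Measure.pi fun _ : Fin n => μ).withDensity fun xs =>
          (ellDens f0 f1 n j (extvec n x xs) : ℝ≥0∞))) hint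
  refine hasSum_conv h (fun j => ?_) rfl
  rw [integral_smul_measure, integral_map (by fun_prop) hF.aestronglyMeasurable,
    integral_withDensity_eq_integral_smul (measurable_ellDens f0 f1 hf0 hf1 n j x)]
  rfl

lemma integrable_of_bdd {Ω : Type*} [MeasurableSpace Ω] (m : Measure Ω) [IsFiniteMeasure m]
    (F : Ω → ℝ) (hF : Measurable F) (C : ℝ) (hC : ∀ w, |F w| ≤ C) : Integrable F m :=
  Integrable.of_bound hF.aestronglyMeasurable C (ae_of_all _ hC)

lemma integral_nu_diff (μ : Measure E) [SigmaFinite μ] (f0 f1 : E → E → ℝ≥0)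
    (hf0 : Measurable (Function.uncurry f0))
    (hf1 : Measurable (Function.uncurry f1))
    (p π : ℝ) (hp : p ∈ Set.Ioo (0 : ℝ) 1) (hπ : π ∈ Set.Ioo (0 : ℝ) 1) (x : E) (n : ℕ)
    (V : (Fin n → E) → ℝ) (F : ℕ × (Fin n → E) → ℝ) (hF : Measurable F)
    (hint : Integrable F (nuMeasure μ f0 f1 p π x n))
    (h1 : ∀ j xs, j ≤ n → F (j, xs) = 0)
    (h2 : ∀ xs, F (n + 1, xs) = p * V xs)
    (h3 : ∀ j xs, n + 1 < j → F (j, xs) = - (1 - p) * V xs) :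
    ∫ w, F w ∂(nuMeasure μ f0 f1 p π x n) = 0 := by
  have hs := hasSum_integral_nu μ f0 f1 hf0 hf1 p π x n F hF hint
  set K := ∫ xs, (ellDens f0 f1 n (n + 1) (extvec n x xs) : ℝ) * V xs
    ∂(Measure.pi fun _ : Fin n => μ) with hK
  refine hs.unique ?_
  have hq : (1 - p) ≠ 0 := by linarith [hp.2]
  have hg := (hasSum_geometric_of_lt_one hp.1.le hp.2).mul_left
    (-(1 - p) * K * ((1 - π) * (1 - p) * p ^ (n + 1)))
  rw [← hasSum_nat_add_iff' (n + 2), Finset.sum_range_succ, Finset.sum_eq_zero]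
  · refine hasSum_conv hg ?_ ?_
    · intro i
      have e : i + (n + 2) = (i + n + 1) + 1 := by ring
      rw [e, prior_succ p π hp hπ]
      have : ∀ xs, (ellDens f0 f1 n (i + n + 1 + 1) (extvec n x xs) : ℝ) * F (i + n + 1 + 1, xs)
          = -(1 - p) * ((ellDens f0 f1 n (n + 1) (extvec n x xs) : ℝ) * V xs) := by
        intro xs
        rw [h3 _ _ (by omega), ellDens_gt f0 f1 n (i + n + 1 + 1) (by omega)]
        ring
      simp only [this]
      rw [integral_const_mul, ← hK]
      ring
    · rw [prior_succ p π hp hπ]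
      have : ∀ xs, (ellDens f0 f1 n (n + 1) (extvec n x xs) : ℝ) * F (n + 1, xs)
          = p * ((ellDens f0 f1 n (n + 1) (extvec n x xs) : ℝ) * V xs) := by
        intro xs
        rw [h2]
        ring
      simp only [this]
      rw [integral_const_mul, ← hK]
      field_simp
      ring
  · intro j hj
    have hj' : j ≤ n := by have := Finset.mem_range.1 hj; omega
    simp [h1 j _ hj']

/-- `∫ u(y) f(z,y) μ(dy)` -/
noncomputable def Ufn (μ : Measure E) (u : E → ℝ) (f : E → E → ℝ≥0) (z : E) : ℝ :=
  ∫ y, u y * (f z y : ℝ) ∂μ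

lemma measurable_Ufn (μ : Measure E) [SigmaFinite μ] (u : E → ℝ) (hu : Measurable u)
    (f : E → E → ℝ≥0) (hf : Measurable (Function.uncurry f)) : Measurable (Ufn μ u f) := by
  have h : Measurable (fun z : E × E => u z.2 * ((Function.uncurry f z : ℝ≥0) : ℝ)) := by fun_prop
  exact (h.stronglyMeasurable.integral_prod_right (ν := μ)).measurable

lemma integrable_dens (μ : Measure E)
    (f : E → E → ℝ≥0) (hf : Measurable (Function.uncurry f))
    (hi : ∀ z, ∫⁻ y, (f z y : ℝ≥0∞) ∂μ = 1) (z : E) : Integrable (fun y => (f z y : ℝ)) μ := by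
  have hm : Measurable (f z) := hf.of_uncurry_left
  refine ⟨by fun_prop, ?_⟩
  simp [HasFiniteIntegral, hi z]

lemma integrable_udens (μ : Measure E) (u : E → ℝ) (hu : Measurable u) (C : ℝ)
    (hC : ∀ y, |u y| ≤ C)
    (f : E → E → ℝ≥0) (hf : Measurable (Function.uncurry f))
    (hi : ∀ z, ∫⁻ y, (f z y : ℝ≥0∞) ∂μ = 1) (z : E) :
    Integrable (fun y => u y * (f z y : ℝ)) μ :=
  (integrable_dens μ f hf hi z).bdd_mul hu.aestronglyMeasurable (ae_of_all _ hC)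

lemma abs_Ufn_le (μ : Measure E) (u : E → ℝ) (hu : Measurable u) (C : ℝ)
    (hC : ∀ y, |u y| ≤ C)
    (f : E → E → ℝ≥0) (hf : Measurable (Function.uncurry f))
    (hi : ∀ z, ∫⁻ y, (f z y : ℝ≥0∞) ∂μ = 1) (z : E) : |Ufn μ u f z| ≤ C := by
  have h1 : ∫ y, (f z y : ℝ) ∂μ = 1 := by
    have hm : Measurable (f z) := hf.of_uncurry_left
    rw [integral_eq_lintegral_of_nonneg_ae (ae_of_all _ fun y => NNReal.coe_nonneg (f z y)) (by fun_prop)]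
    simp [hi z]
  unfold Ufn
  rw [← Real.norm_eq_abs]
  refine (norm_integral_le_of_norm_le ((integrable_dens μ f hf hi z).const_mul C)
    (ae_of_all _ fun y => ?_)).trans ?_
  · rw [norm_mul, Real.norm_eq_abs, Real.norm_eq_abs, abs_of_nonneg (NNReal.coe_nonneg (f z y))]
    exact mul_le_mul_of_nonneg_right (hC y) (NNReal.coe_nonneg (f z y))
  · rw [integral_const_mul, h1, mul_one]

lemma integral_nextK (μ : Measure E) [SigmaFinite μ] (f0 f1 : E → E → ℝ≥0)
    (hf0 : Measurable (Function.uncurry f0))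
    (hf1 : Measurable (Function.uncurry f1)) (n : ℕ) (x : E) (u : E → ℝ)
    (w : ℕ × (Fin n → E)) :
    ∫ y, u y ∂(nextK μ f0 f1 n x w) =
      if w.1 ≤ n + 1 then Ufn μ u f1 (extvec n x w.2 n) else Ufn μ u f0 (extvec n x w.2 n) := by
  rw [nextK, Kernel.integral_withDensity (measurable_nextD f0 f1 hf0 hf1 n x)]
  simp only [Kernel.const_apply, nextD, stepD, Ufn]
  by_cases h : w.1 ≤ n + 1
  · simp only [h, if_true, NNReal.smul_def, smul_eq_mul, mul_comm]
  · simp only [h, if_false, NNReal.smul_def, smul_eq_mul, mul_comm]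

lemma Ffil_le (n m : ℕ) (h : m ≤ n) :
    Ffil (E := E) n m h ≤ (inferInstance : MeasurableSpace (ℕ × (Fin n → E))) := by
  unfold Ffil
  refine Measurable.comap_le ?_
  fun_prop

/-- The key identity of set integrals. -/
lemma key_setIntegral (μ : Measure E) [SigmaFinite μ]
    (f0 f1 : E → E → ℝ≥0) (hf0 : Measurable (Function.uncurry f0))
    (hf1 : Measurable (Function.uncurry f1))
    (hi0 : ∀ z, ∫⁻ y, (f0 z y : ℝ≥0∞) ∂μ = 1) (hi1 : ∀ z, ∫⁻ y, (f1 z y : ℝ≥0∞) ∂μ = 1)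
    (p π : ℝ) (hp : p ∈ Set.Ioo (0 : ℝ) 1) (hπ : π ∈ Set.Ioo (0 : ℝ) 1)
    (x : E) (n : ℕ) (u : E → ℝ) (hu : Measurable u) (C : ℝ) (hC : ∀ y, |u y| ≤ C)
    (B : Set (Fin n → E)) (hB : MeasurableSet B) :
    ∫ w in (fun w : ℕ × (Fin (n + 1) → E) => firstv n w.2) ⁻¹' B, u (w.2 (Fin.last n))
        ∂(nuMeasure μ f0 f1 p π x (n + 1)) =
      ∫ w in (fun w : ℕ × (Fin (n + 1) → E) => firstv n w.2) ⁻¹' B,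
        (((1 - p) * Ufn μ u f1 (extvec n x (firstv n w.2) n)
            + p * Ufn μ u f0 (extvec n x (firstv n w.2) n)) +
          (p * (Ufn μ u f1 (extvec n x (firstv n w.2) n)
            - Ufn μ u f0 (extvec n x (firstv n w.2) n))) *
            Set.indicator {w' : ℕ × (Fin (n + 1) → E) | w'.1 ≤ n} (fun _ => (1 : ℝ)) w)
        ∂(nuMeasure μ f0 f1 p π x (n + 1)) := by
  have fin0 := isFinite_nu μ f0 f1 hf0 hf1 hi0 hi1 p π hp hπ x n
  have fin1 := isFinite_nu μ f0 f1 hf0 hf1 hi0 hi1 p π hp hπ x (n + 1)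
  have hmk := isMarkov_nextK μ f0 f1 hf0 hf1 hi0 hi1 n x
  have hmap := map_nu μ f0 f1 hf0 hf1 hi0 hi1 p π hp hπ x n
  have hA : MeasurableSet ((fun w : ℕ × (Fin (n + 1) → E) => firstv n w.2) ⁻¹' B) :=
    (show Measurable (fun w : ℕ × (Fin (n + 1) → E) => firstv n w.2) by fun_prop) hB
  have mU0 := measurable_Ufn μ u hu f0 hf0
  have mU1 := measurable_Ufn μ u hu f1 hf1
  have bU0 := abs_Ufn_le μ u hu C hC f0 hf0 hi0
  have bU1 := abs_Ufn_le μ u hu C hC f1 hf1 hi1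
  have hC0 : 0 ≤ C := (abs_nonneg _).trans (hC x)
  let I : (Fin n → E) → ℝ := B.indicator (fun _ => 1)
  have mI : Measurable I := measurable_const.indicator hB
  have bI : ∀ xs, |I xs| ≤ 1 := by
    intro xs
    by_cases h : xs ∈ B <;> simp [I, h]
  let J : ℕ → ℝ := fun j => if j ≤ n then 1 else 0
  have mJ : Measurable J := measurable_from_top
  have bJ : ∀ j, |J j| ≤ 1 := by
    intro j
    by_cases h : j ≤ n <;> simp [J, h]
  let U0 : (Fin n → E) → ℝ := fun xs => Ufn μ u f0 (extvec n x xs n)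
  let U1 : (Fin n → E) → ℝ := fun xs => Ufn μ u f1 (extvec n x xs n)
  have mU0' : Measurable U0 := mU0.comp (measurable_extvec n x n)
  have mU1' : Measurable U1 := mU1.comp (measurable_extvec n x n)
  let G : (ℕ × (Fin n → E)) × E → ℝ := fun z => I z.1.2 * u z.2
  let H : ℕ × (Fin n → E) → ℝ := fun w =>
    I w.2 * (((1 - p) * U1 w.2 + p * U0 w.2) + (p * (U1 w.2 - U0 w.2)) * J w.1)
  let T : ℕ × (Fin n → E) → ℝ := fun w => I w.2 * (if w.1 ≤ n + 1 then U1 w.2 else U0 w.2)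
  have mG : Measurable G := by fun_prop
  have mH : Measurable H := by fun_prop
  have mT : Measurable T := by
    refine (mI.comp measurable_snd).mul (Measurable.ite ?_ (by fun_prop) (by fun_prop))
    exact measurable_fst (measurableSet_Iic (a := n + 1))
  have bG : ∀ z, |G z| ≤ C := by
    intro z
    simp only [G, abs_mul]
    calc _ ≤ 1 * C := mul_le_mul (bI _) (hC _) (abs_nonneg _) zero_le_one
      _ = C := one_mul C
  have bT : ∀ z, |T z| ≤ C := by
    intro z
    simp only [T, abs_mul]
    have : |(if z.1 ≤ n + 1 then U1 z.2 else U0 z.2)| ≤ C := by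
      split_ifs
      · exact bU1 _
      · exact bU0 _
    calc _ ≤ 1 * C := mul_le_mul (bI _) this (abs_nonneg _) zero_le_one
      _ = C := one_mul C
  have bH : ∀ z, |H z| ≤ C := by
    intro z
    simp only [H, abs_mul]
    have h0 : |U0 z.2| ≤ C := bU0 _
    have h1 : |U1 z.2| ≤ C := bU1 _
    have : |((1 - p) * U1 z.2 + p * U0 z.2) + (p * (U1 z.2 - U0 z.2)) * J z.1| ≤ C := by
      by_cases h : z.1 ≤ n
      · simp only [J, h, if_true]
        convert h1 using 2
        ring
      · simp only [J, h, if_false, mul_zero, add_zero]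
        rw [abs_le] at *
        have := hp.1
        have := hp.2
        constructor <;> nlinarith
    calc _ ≤ 1 * C := mul_le_mul (bI _) this (abs_nonneg _) zero_le_one
      _ = C := one_mul C
  have L1 : ∫ w in (fun w : ℕ × (Fin (n + 1) → E) => firstv n w.2) ⁻¹' B, u (w.2 (Fin.last n))
        ∂(nuMeasure μ f0 f1 p π x (n + 1)) = ∫ w, T w ∂(nuMeasure μ f0 f1 p π x n) := by
    rw [← integral_indicator hA]
    have e : ∀ w, ((fun w : ℕ × (Fin (n + 1) → E) => firstv n w.2) ⁻¹' B).indicator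
        (fun w => u (w.2 (Fin.last n))) w = G (splitv n w) := by
      intro w
      by_cases h : firstv n w.2 ∈ B <;> simp [G, I, splitv, h]
    simp only [e]
    rw [← integral_map (φ := splitv n) (f := G) (by fun_prop) mG.aestronglyMeasurable, hmap,
      Measure.integral_compProd (integrable_of_bdd _ G mG C bG)]
    congr 1
    funext w
    simp only [G, T]
    rw [integral_const_mul, integral_nextK μ f0 f1 hf0 hf1 n x u w]
  have L2 : ∫ w in (fun w : ℕ × (Fin (n + 1) → E) => firstv n w.2) ⁻¹' B,
        (((1 - p) * Ufn μ u f1 (extvec n x (firstv n w.2) n)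
            + p * Ufn μ u f0 (extvec n x (firstv n w.2) n)) +
          (p * (Ufn μ u f1 (extvec n x (firstv n w.2) n)
            - Ufn μ u f0 (extvec n x (firstv n w.2) n))) *
            Set.indicator {w' : ℕ × (Fin (n + 1) → E) | w'.1 ≤ n} (fun _ => (1 : ℝ)) w)
        ∂(nuMeasure μ f0 f1 p π x (n + 1)) = ∫ w, H w ∂(nuMeasure μ f0 f1 p π x n) := by
    rw [← integral_indicator hA]
    have e : ∀ w, ((fun w : ℕ × (Fin (n + 1) → E) => firstv n w.2) ⁻¹' B).indicator
        (fun w => (((1 - p) * Ufn μ u f1 (extvec n x (firstv n w.2) n)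
            + p * Ufn μ u f0 (extvec n x (firstv n w.2) n)) +
          (p * (Ufn μ u f1 (extvec n x (firstv n w.2) n)
            - Ufn μ u f0 (extvec n x (firstv n w.2) n))) *
            Set.indicator {w' : ℕ × (Fin (n + 1) → E) | w'.1 ≤ n} (fun _ => (1 : ℝ)) w)) w
        = (fun z : (ℕ × (Fin n → E)) × E => H z.1) (splitv n w) := by
      intro w
      by_cases h : firstv n w.2 ∈ B <;> by_cases h' : w.1 ≤ n <;>
        simp [H, I, J, U0, U1, splitv, h, h']
    simp only [e]
    rw [← integral_map (φ := splitv n) (f := fun z : (ℕ × (Fin n → E)) × E => H z.1)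
      (by fun_prop) (mH.comp measurable_fst).aestronglyMeasurable, hmap,
      Measure.integral_compProd (integrable_of_bdd _ (fun z : (ℕ × (Fin n → E)) × E => H z.1)
        (mH.comp measurable_fst) C
        (fun z => bH z.1))]
    simp
  rw [L1, L2, ← sub_eq_zero]
  have iT := integrable_of_bdd (nuMeasure μ f0 f1 p π x n) T mT C bT
  have iH := integrable_of_bdd (nuMeasure μ f0 f1 p π x n) H mH C bH
  rw [← integral_sub iT iH]
  refine integral_nu_diff μ f0 f1 hf0 hf1 p π hp hπ x n (fun xs => I xs * (U1 xs - U0 xs))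
    (fun w => T w - H w) (mT.sub mH) (iT.sub iH) ?_ ?_ ?_
  · intro j xs hj
    have : j ≤ n + 1 := by omega
    simp only [T, H, J, hj, this, if_true]
    ring
  · intro xs
    have : ¬ n + 1 ≤ n := by omega
    simp only [T, H, J, this, if_false, le_refl, if_true]
    ring
  · intro j xs hj
    have h1 : ¬ j ≤ n := by omega
    have h2 : ¬ j ≤ n + 1 := by omega
    simp only [T, H, J, h1, h2, if_false]
    ring

end helpers

/-- Conditional law of the next observation: in the model with horizon `n+1`,
for bounded measurable `u`, `ν`-a.e.
`E_ν[u(X_{n+1}) | 𝓕_n] = ∫ u(y)(p(1-Π_n) f⁰(X_n,y) + (q + pΠ_n) f¹(X_n,y)) μ(dy)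
                       = ∫ u(y) G₁(X_n, y, Π_n) μ(dy)`, where `Π_n = ν(θ ≤ n | 𝓕_n)`. -/
theorem stmt13 {E : Type*} [MeasurableSpace E] (μ : Measure E) [SigmaFinite μ]
    (f0 f1 : E → E → ℝ≥0) (hf0 : Measurable (Function.uncurry f0))
    (hf1 : Measurable (Function.uncurry f1))
    (hi0 : ∀ z, ∫⁻ y, (f0 z y : ℝ≥0∞) ∂μ = 1) (hi1 : ∀ z, ∫⁻ y, (f1 z y : ℝ≥0∞) ∂μ = 1)
    (p π : ℝ) (hp : p ∈ Set.Ioo (0 : ℝ) 1) (hπ : π ∈ Set.Ioo (0 : ℝ) 1)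
    (x : E) (n : ℕ) (hn : 1 ≤ n)
    (u : E → ℝ) (hu : Measurable u) (hub : ∃ C, ∀ y, |u y| ≤ C) :
    ∀ᵐ ω ∂(nuMeasure μ f0 f1 p π x (n + 1)),
      (((nuMeasure μ f0 f1 p π x (n + 1))[fun ω' : ℕ × (Fin (n + 1) → E) =>
            u (extvec (n + 1) x ω'.2 (n + 1)) | Ffil (n + 1) n (Nat.le_succ n)]) ω =
        ∫ y, u y *
          (p * (1 - ((nuMeasure μ f0 f1 p π x (n + 1))[Set.indicator
                {ω' : ℕ × (Fin (n + 1) → E) | ω'.1 ≤ n} (fun _ => (1 : ℝ)) |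
                Ffil (n + 1) n (Nat.le_succ n)]) ω) * (f0 (extvec (n + 1) x ω.2 n) y : ℝ) +
            ((1 - p) + p * ((nuMeasure μ f0 f1 p π x (n + 1))[Set.indicator
                {ω' : ℕ × (Fin (n + 1) → E) | ω'.1 ≤ n} (fun _ => (1 : ℝ)) |
                Ffil (n + 1) n (Nat.le_succ n)]) ω) * (f1 (extvec (n + 1) x ω.2 n) y : ℝ)) ∂μ) ∧
      (∫ y, u y *
          (p * (1 - ((nuMeasure μ f0 f1 p π x (n + 1))[Set.indicator
                {ω' : ℕ × (Fin (n + 1) → E) | ω'.1 ≤ n} (fun _ => (1 : ℝ)) |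
                Ffil (n + 1) n (Nat.le_succ n)]) ω) * (f0 (extvec (n + 1) x ω.2 n) y : ℝ) +
            ((1 - p) + p * ((nuMeasure μ f0 f1 p π x (n + 1))[Set.indicator
                {ω' : ℕ × (Fin (n + 1) → E) | ω'.1 ≤ n} (fun _ => (1 : ℝ)) |
                Ffil (n + 1) n (Nat.le_succ n)]) ω) * (f1 (extvec (n + 1) x ω.2 n) y : ℝ)) ∂μ) =
        ∫ y, u y * G1fn f0 f1 p (extvec (n + 1) x ω.2 n) y
          (((nuMeasure μ f0 f1 p π x (n + 1))[Set.indicator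
            {ω' : ℕ × (Fin (n + 1) → E) | ω'.1 ≤ n} (fun _ => (1 : ℝ)) |
            Ffil (n + 1) n (Nat.le_succ n)]) ω) ∂μ := by
  obtain ⟨C, hC⟩ := hub
  have fin1 := isFinite_nu μ f0 f1 hf0 hf1 hi0 hi1 p π hp hπ x (n + 1)
  have hle := Ffil_le (E := E) (n + 1) n (Nat.le_succ n)
  set ν := nuMeasure μ f0 f1 p π x (n + 1) with hν
  let S : ℕ × (Fin (n + 1) → E) → ℝ :=
    Set.indicator {ω' : ℕ × (Fin (n + 1) → E) | ω'.1 ≤ n} (fun _ => (1 : ℝ))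
  have mS : Measurable S :=
    measurable_const.indicator (measurable_fst (measurableSet_Iic (a := n)))
  have bS : ∀ w, |S w| ≤ 1 := by
    intro w
    by_cases h : w.1 ≤ n <;> simp [S, h]
  have iS : Integrable S ν := integrable_of_bdd ν S mS 1 bS
  have mU0 := measurable_Ufn μ u hu f0 hf0
  have mU1 := measurable_Ufn μ u hu f1 hf1
  have bU0 := abs_Ufn_le μ u hu C hC f0 hf0 hi0
  have bU1 := abs_Ufn_le μ u hu C hC f1 hf1 hi1
  have mi : Measurable[Ffil (n + 1) n (Nat.le_succ n)]
      (fun w : ℕ × (Fin (n + 1) → E) => firstv n w.2) := by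
    unfold Ffil
    exact comap_measurable _
  let a' : (Fin n → E) → ℝ := fun xs => (1 - p) * Ufn μ u f1 (extvec n x xs n)
    + p * Ufn μ u f0 (extvec n x xs n)
  let b' : (Fin n → E) → ℝ := fun xs => p * (Ufn μ u f1 (extvec n x xs n)
    - Ufn μ u f0 (extvec n x xs n))
  have ma' : Measurable a' := by
    have h0 := mU0.comp (measurable_extvec n x n)
    have h1 := mU1.comp (measurable_extvec n x n)
    exact (h1.const_mul _).add (h0.const_mul _)
  have mb' : Measurable b' := by
    have h0 := mU0.comp (measurable_extvec n x n)
    have h1 := mU1.comp (measurable_extvec n x n)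
    exact (h1.sub h0).const_mul _
  let a : ℕ × (Fin (n + 1) → E) → ℝ := fun w => a' (firstv n w.2)
  let b : ℕ × (Fin (n + 1) → E) → ℝ := fun w => b' (firstv n w.2)
  have ma : Measurable[Ffil (n + 1) n (Nat.le_succ n)] a := ma'.comp mi
  have mb : Measurable[Ffil (n + 1) n (Nat.le_succ n)] b := mb'.comp mi
  have ba : ∀ w, |a w| ≤ |1 - p| * C + |p| * C := by
    intro w
    refine (abs_add_le _ _).trans ?_
    rw [abs_mul, abs_mul]
    gcongr
    · exact bU1 _
    · exact bU0 _
  have bb : ∀ w, |b w| ≤ |p| * (C + C) := by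
    intro w
    simp only [b, b']
    rw [abs_mul]
    gcongr
    exact (abs_sub _ _).trans (add_le_add (bU1 _) (bU0 _))
  have ia : Integrable a ν := integrable_of_bdd ν a (ma.mono hle le_rfl) _ ba
  have ibS : Integrable (b * S) ν :=
    iS.bdd_mul (mb.mono hle le_rfl).aestronglyMeasurable (ae_of_all _ bb)
  have c1 : ν[a + b * S | Ffil (n + 1) n (Nat.le_succ n)] =ᵐ[ν]
      a + b * ν[S | Ffil (n + 1) n (Nat.le_succ n)] := by
    refine (condExp_add ia ibS _).trans ?_
    rw [condExp_of_stronglyMeasurable hle ma.stronglyMeasurable ia]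
    exact (Filter.EventuallyEq.refl _ a).add
      (condExp_mul_of_stronglyMeasurable_left mb.stronglyMeasurable ibS iS)
  have iu : Integrable (fun ω' : ℕ × (Fin (n + 1) → E) =>
      u (extvec (n + 1) x ω'.2 (n + 1))) ν := by
    refine integrable_of_bdd ν _ ?_ C (fun w => hC _)
    exact hu.comp ((measurable_extvec (n + 1) x (n + 1)).comp measurable_snd)
  have c2 : ν[a + b * S | Ffil (n + 1) n (Nat.le_succ n)] =ᵐ[ν]
      ν[fun ω' : ℕ × (Fin (n + 1) → E) =>
            u (extvec (n + 1) x ω'.2 (n + 1)) | Ffil (n + 1) n (Nat.le_succ n)] := by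
    refine ae_eq_condExp_of_forall_setIntegral_eq hle iu
      (fun s _ _ => integrable_condExp.integrableOn) ?_
      stronglyMeasurable_condExp.aestronglyMeasurable
    intro s hs _
    rw [setIntegral_condExp hle (ia.add ibS) hs]
    obtain ⟨B, hB, rfl⟩ := hs
    simp only [extvec_last]
    exact (key_setIntegral μ f0 f1 hf0 hf1 hi0 hi1 p π hp hπ x n u hu C hC B hB).symm
  filter_upwards [c1, c2] with w h1 h2
  rw [← h2, h1]
  refine ⟨?_, ?_⟩
  · simp only [Pi.add_apply, Pi.mul_apply, a, b, a', b']
    rw [extvec_first n x w.2 n le_rfl]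
    change _ + _ * (ν[S | Ffil (n + 1) n (Nat.le_succ n)]) w = ∫ y, u y *
      (p * (1 - (ν[S | Ffil (n + 1) n (Nat.le_succ n)]) w) * _ +
        ((1 - p) + p * (ν[S | Ffil (n + 1) n (Nat.le_succ n)]) w) * _) ∂μ
    generalize (ν[S | Ffil (n + 1) n (Nat.le_succ n)]) w = Z
    generalize extvec n x (firstv n w.2) n = z
    have e : ∀ y, u y * (p * (1 - Z) * (f0 z y : ℝ) + ((1 - p) + p * Z) * (f1 z y : ℝ)) =
        p * (1 - Z) * (u y * (f0 z y : ℝ)) + ((1 - p) + p * Z) * (u y * (f1 z y : ℝ)) := by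
      intro y
      ring
    simp only [e]
    rw [integral_add ((integrable_udens μ u hu C hC f0 hf0 hi0 z).const_mul _)
      ((integrable_udens μ u hu C hC f1 hf1 hi1 z).const_mul _), integral_const_mul,
      integral_const_mul]
    unfold Ufn
    ring
  · congr 1
    funext y
    unfold G1fn
    ring
end
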